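/- arXiv:1409.3317 — 5 statements merged into one kernel-verified Lean document; each statement's English description precedes it below -/
import Mathlib

section
/- Let p and q be distinct prime numbers, let h be a positive integer, and let a ∈ ℤ. Suppose there exists an element ε of the Galois field F = 𝔽_{p²} with p² elements such that ε^12 = 1 and, in F, the image of a equals (ε + ε⁻¹) times the image of q^h. Then p divides the integer a·(a² − q^{2h})·(a² − 4·q^{2h})·(a² − 3·q^{2h}). -/
theorem mul_add_inv_of_pow_twelve_eq_one {F : Type*} [Field F] {ε : F} (hε : ε ^ 12 = 1) :
    (ε + ε⁻¹) * ((ε + ε⁻¹) ^ 2 - 1) * ((ε + ε⁻¹) ^ 2 - 4) * ((ε + ε⁻¹) ^ 2 - 3) = 0 := by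
  have h0 : ε ≠ 0 := by
    rintro rfl
    simp at hε
  have key : ε ^ 7 * ((ε + ε⁻¹) * ((ε + ε⁻¹) ^ 2 - 1) * ((ε + ε⁻¹) ^ 2 - 4) *
      ((ε + ε⁻¹) ^ 2 - 3)) = (ε ^ 2 - 1) * (ε ^ 12 - 1) := by
    field_simp
    ring
  rw [hε, sub_self, mul_zero] at key
  exact (mul_eq_zero.mp key).resolve_left (pow_ne_zero 7 h0)

theorem p_dvd_product (p q : ℕ) [Fact (Nat.Prime p)] (hq : Nat.Prime q)
    (hpq : p ≠ q) (h : ℕ) (hh : 0 < h) (a : ℤ)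
    (hε : ∃ ε : GaloisField p 2, ε ^ 12 = 1 ∧
      (a : GaloisField p 2) = (ε + ε⁻¹) * (((q : ℤ) ^ h : ℤ) : GaloisField p 2)) :
    (p : ℤ) ∣ a * (a ^ 2 - (q : ℤ) ^ (2 * h)) * (a ^ 2 - 4 * (q : ℤ) ^ (2 * h)) *
      (a ^ 2 - 3 * (q : ℤ) ^ (2 * h)) := by
  obtain ⟨ε, hε, ha⟩ := hε
  have key := mul_add_inv_of_pow_twelve_eq_one hε
  rw [← CharP.intCast_eq_zero_iff (GaloisField p 2) p, mul_comm 2 h, pow_mul]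
  generalize (q : ℤ) ^ h = Q at ha ⊢
  push_cast
  rw [ha]
  linear_combination (Q : GaloisField p 2) ^ 7 * key
end

section
/- Let p and q be distinct prime numbers, let h be a positive integer, and let a ∈ ℤ. Suppose there exists an element ε of the Galois field F = 𝔽_{p²} with ε^12 = 1 such that, in F, the image of a equals (ε + ε⁻¹) times the image of q^h. Suppose moreover that each of the integers a, a + q^h, a − q^h, a + 2q^h, a − 2q^h, and a² − 3q^{2h} is either zero or not divisible by p. Then a ∈ {0, q^h, −q^h, 2q^h, −2q^h} or a² = 3·q^{2h}. -/
/-- The possible traces `ε + ε⁻¹` of a twelfth root of unity in a field. -/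
theorem add_inv_of_pow_twelve_eq_one {K : Type*} [Field K] {ε : K} (hε : ε ^ 12 = 1) :
    ε + ε⁻¹ = 0 ∨ ε + ε⁻¹ = -1 ∨ ε + ε⁻¹ = 1 ∨ ε + ε⁻¹ = -2 ∨ ε + ε⁻¹ = 2 ∨
      (ε + ε⁻¹) ^ 2 = 3 := by
  have h0 : ε ≠ 0 := by
    rintro rfl
    simp at hε
  have key : (ε + ε⁻¹) * (ε + ε⁻¹ + 1) * (ε + ε⁻¹ - 1) * (ε + ε⁻¹ + 2) * (ε + ε⁻¹ - 2) *
      ((ε + ε⁻¹) ^ 2 - 3) = 0 := by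
    field_simp
    linear_combination (ε ^ 2 - 1) * hε
  simpa only [mul_eq_zero, sub_eq_zero, add_eq_zero_iff_eq_neg, or_assoc] using key


theorem a_values_from_congruence (p q : ℕ) [Fact (Nat.Prime p)] (hq : Nat.Prime q)
    (hpq : p ≠ q) (h : ℕ) (hh : 0 < h) (a : ℤ)
    (hε : ∃ ε : GaloisField p 2, ε ^ 12 = 1 ∧
      (a : GaloisField p 2) = (ε + ε⁻¹) * (((q : ℤ) ^ h : ℤ) : GaloisField p 2))
    (H0 : a = 0 ∨ ¬ (p : ℤ) ∣ a)
    (H1 : a + (q : ℤ) ^ h = 0 ∨ ¬ (p : ℤ) ∣ (a + (q : ℤ) ^ h))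
    (H2 : a - (q : ℤ) ^ h = 0 ∨ ¬ (p : ℤ) ∣ (a - (q : ℤ) ^ h))
    (H3 : a + 2 * (q : ℤ) ^ h = 0 ∨ ¬ (p : ℤ) ∣ (a + 2 * (q : ℤ) ^ h))
    (H4 : a - 2 * (q : ℤ) ^ h = 0 ∨ ¬ (p : ℤ) ∣ (a - 2 * (q : ℤ) ^ h))
    (H5 : a ^ 2 - 3 * (q : ℤ) ^ (2 * h) = 0 ∨ ¬ (p : ℤ) ∣ (a ^ 2 - 3 * (q : ℤ) ^ (2 * h))) :
    (a = 0 ∨ a = (q : ℤ) ^ h ∨ a = -(q : ℤ) ^ h ∨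
      a = 2 * (q : ℤ) ^ h ∨ a = -(2 * (q : ℤ) ^ h)) ∨
      a ^ 2 = 3 * (q : ℤ) ^ (2 * h) := by
  obtain ⟨ε, hε, ha⟩ := hε
  have no_dvd {n : ℤ} (hn : n = 0 ∨ ¬ (p : ℤ) ∣ n) (h0 : (n : GaloisField p 2) = 0) : n = 0 :=
    hn.resolve_right (not_not_intro ((CharP.intCast_eq_zero_iff _ p n).1 h0))
  push_cast at ha
  rcases add_inv_of_pow_twelve_eq_one hε with ht | ht | ht | ht | ht | ht
  · have := no_dvd H0 (by rw [ha, ht, zero_mul])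
    tauto
  · have := no_dvd H1 (by push_cast; rw [ha, ht]; ring)
    grind
  · have := no_dvd H2 (by push_cast; rw [ha, ht]; ring)
    grind
  · have := no_dvd H3 (by push_cast; rw [ha, ht]; ring)
    grind
  · have := no_dvd H4 (by push_cast; rw [ha, ht]; ring)
    grind
  · exact .inr (sub_eq_zero.1 (no_dvd H5 (by push_cast; rw [ha, mul_pow, ht]; ring)))
end

section
/- D(2,4) = {0, 1, −3, 4, −4, 5, −7, 8, −8, 9, 12, −12, 16, −16, −47}. -/
/-- The set `C(N,e)` of power sums `α^e + conj(α)^e` where `α` ranges over roots of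
polynomials `T² + sT + N` with `s ∈ ℤ`, `s² ≤ 4N`. -/
def Cset (N e : ℕ) : Set ℤ :=
  {m : ℤ | ∃ s : ℤ, s ^ 2 ≤ 4 * (N : ℤ) ∧
    ∃ α : ℂ, α ^ 2 + (s : ℂ) * α + (N : ℂ) = 0 ∧
      α ^ e + (starRingEnd ℂ) α ^ e = (m : ℂ)}

/-- For `e` even, the set `D(N,e) = { a, a ± N^(e/2), a ± 2N^(e/2), a² − 3N^e : a ∈ C(N,e) }`. -/
def Dset (N e : ℕ) : Set ℤ :=
  {d : ℤ | ∃ a ∈ Cset N e,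
    d = a ∨ d = a + (N : ℤ) ^ (e / 2) ∨ d = a - (N : ℤ) ^ (e / 2) ∨
    d = a + 2 * (N : ℤ) ^ (e / 2) ∨ d = a - 2 * (N : ℤ) ^ (e / 2) ∨
    d = a ^ 2 - 3 * (N : ℤ) ^ e}

/-- The complex conjugate of a root of a real quadratic with nonpositive discriminant is the
other root. -/
theorem conj_eq_of_quadratic_root {b c : ℝ} (h : b ^ 2 ≤ 4 * c) {α : ℂ}
    (hα : α ^ 2 + b * α + c = 0) : (starRingEnd ℂ) α = -b - α := by
  have hre := congrArg Complex.re hα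
  have him := congrArg Complex.im hα
  simp [pow_two] at hre him
  have hx : 2 * α.re + b = 0 := by
    by_cases hy : α.im = 0
    · rw [hy] at hre
      nlinarith [sq_nonneg (2 * α.re + b)]
    · exact mul_left_cancel₀ hy (by linarith)
  apply Complex.ext
  · simp
    linarith
  · simp

theorem pow_four_add_conj_pow_four {b c : ℝ} (h : b ^ 2 ≤ 4 * c) {α : ℂ}
    (hα : α ^ 2 + b * α + c = 0) :
    α ^ 4 + (starRingEnd ℂ) α ^ 4 = b ^ 4 - 4 * c * b ^ 2 + 2 * c ^ 2 := by
  rw [conj_eq_of_quadratic_root h hα]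
  linear_combination (2 * α ^ 2 + 2 * b * α + 4 * b ^ 2 - 2 * c) * hα

theorem mem_Cset_four {N : ℕ} {m : ℤ} :
    m ∈ Cset N 4 ↔
      ∃ s : ℤ, s ^ 2 ≤ 4 * (N : ℤ) ∧ m = s ^ 4 - 4 * N * s ^ 2 + 2 * (N : ℤ) ^ 2 := by
  have key (s : ℤ) (hs : s ^ 2 ≤ 4 * (N : ℤ)) (α : ℂ)
      (hα : α ^ 2 + (s : ℂ) * α + (N : ℂ) = 0) : α ^ 4 + (starRingEnd ℂ) α ^ 4 =
        ((s ^ 4 - 4 * N * s ^ 2 + 2 * (N : ℤ) ^ 2 : ℤ) : ℂ) := by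
    have hs' : (s : ℝ) ^ 2 ≤ 4 * (N : ℝ) := by exact_mod_cast hs
    simpa using pow_four_add_conj_pow_four hs' (by simpa using hα)
  constructor
  · rintro ⟨s, hs, α, hα, hm⟩
    rw [key s hs α hα] at hm
    exact ⟨s, hs, by exact_mod_cast hm.symm⟩
  · rintro ⟨s, hs, rfl⟩
    obtain ⟨d, hd⟩ := IsAlgClosed.exists_pow_nat_eq ((s : ℂ) ^ 2 - 4 * N) two_pos
    have hα : ((-s + d) / 2) ^ 2 + (s : ℂ) * ((-s + d) / 2) + (N : ℂ) = 0 := by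
      linear_combination hd / 4
    exact ⟨s, hs, _, hα, key s hs _ hα⟩

theorem Cset_two_four : Cset 2 4 = {8, 1, -8} := by
  ext m
  rw [mem_Cset_four]
  constructor
  · rintro ⟨s, hs, rfl⟩
    push_cast at hs
    have h1 : -2 ≤ s := by nlinarith
    have h2 : s ≤ 2 := by nlinarith
    interval_cases s <;> simp
  · rintro (rfl | rfl | rfl)
    exacts [⟨0, by norm_num⟩, ⟨1, by norm_num⟩, ⟨2, by norm_num⟩]

theorem Dset_two_four :
    Dset 2 4 = {0, 1, -3, 4, -4, 5, -7, 8, -8, 9, 12, -12, 16, -16, -47} := by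
  ext d
  simp only [Dset, Cset_two_four, Set.mem_ofPred_eq, Set.mem_insert_iff, Set.mem_singleton_iff,
    exists_eq_or_imp, exists_eq_left]
  norm_num
  omega
end

section
/- P(D(2,4)) = {2, 3, 5, 7, 47}; that is, the set of prime numbers dividing some nonzero element of D(2,4) equals {2, 3, 5, 7, 47}. -/
/-- The set of prime numbers dividing some nonzero element of `D`. -/
def Pset (D : Set ℤ) : Set ℕ :=
  {p : ℕ | p.Prime ∧ ∃ d ∈ D, d ≠ 0 ∧ (p : ℤ) ∣ d}

/-- A root of a real quadratic `T² + sT + N` with nonpositive discriminant has trace `-s`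
and norm `N`. -/
theorem trace_norm_of_root {s N : ℝ} (hs : s ^ 2 ≤ 4 * N) {α : ℂ}
    (hα : α ^ 2 + (s : ℂ) * α + (N : ℂ) = 0) :
    α + (starRingEnd ℂ) α = -(s : ℂ) ∧ α * (starRingEnd ℂ) α = (N : ℂ) := by
  have hre := congrArg Complex.re hα
  have him := congrArg Complex.im hα
  simp [pow_two] at hre him
  have key : 2 * α.re = -s := by
    have h : α.im * (2 * α.re + s) = 0 := by linarith
    rcases mul_eq_zero.mp h with h | h
    · rw [h] at hre
      nlinarith [sq_nonneg (2 * α.re + s)]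
    · linarith
  constructor
  · rw [Complex.add_conj, key]
    push_cast
    rfl
  · rw [Complex.mul_conj, Complex.normSq_apply]
    norm_cast
    linear_combination -hre + α.re * key

/-- A real quadratic `T² + sT + N` with nonpositive discriminant has a complex root. -/
theorem exists_root_of_sq_le (s N : ℝ) (hs : s ^ 2 ≤ 4 * N) :
    ∃ α : ℂ, α ^ 2 + (s : ℂ) * α + (N : ℂ) = 0 := by
  refine ⟨⟨-s / 2, Real.sqrt (4 * N - s ^ 2) / 2⟩, ?_⟩
  have h := Real.mul_self_sqrt (sub_nonneg.mpr hs)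
  apply Complex.ext <;> simp [pow_two] at h ⊢ <;> linarith

/-- The fourth power sums are the values of the polynomial `s⁴ - 4Ns² + 2N²`. -/
theorem mem_Cset_four_iff (N : ℕ) (m : ℤ) :
    m ∈ Cset N 4 ↔
      ∃ s : ℤ, s ^ 2 ≤ 4 * (N : ℤ) ∧ m = s ^ 4 - 4 * N * s ^ 2 + 2 * N ^ 2 := by
  have power_sum : ∀ {s : ℤ}, s ^ 2 ≤ 4 * (N : ℤ) → ∀ {α : ℂ},
      α ^ 2 + (s : ℂ) * α + (N : ℂ) = 0 →
      α ^ 4 + (starRingEnd ℂ) α ^ 4 = ((s ^ 4 - 4 * N * s ^ 2 + 2 * N ^ 2 : ℤ) : ℂ) := by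
    intro s hs α hα
    obtain ⟨ht, hn⟩ := trace_norm_of_root (s := s) (N := N) (by exact_mod_cast hs)
      (by simpa using hα)
    push_cast at ht hn ⊢
    have : α ^ 4 + (starRingEnd ℂ) α ^ 4 = (α + (starRingEnd ℂ) α) ^ 4
        - 4 * (α * (starRingEnd ℂ) α) * (α + (starRingEnd ℂ) α) ^ 2
        + 2 * (α * (starRingEnd ℂ) α) ^ 2 := by ring
    rw [this, ht, hn]
    ring
  constructor
  · rintro ⟨s, hs, α, hα, hm⟩
    exact ⟨s, hs, by exact_mod_cast hm.symm.trans (power_sum hs hα)⟩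
  · rintro ⟨s, hs, rfl⟩
    obtain ⟨α, hα⟩ := exists_root_of_sq_le s N (by exact_mod_cast hs)
    have hα' : α ^ 2 + (s : ℂ) * α + (N : ℂ) = 0 := by simpa using hα
    exact ⟨s, hs, α, hα', power_sum hs hα'⟩

theorem Pset_Dset_two_four : Pset (Dset 2 4) = {2, 3, 5, 7, 47} := by
  ext p
  constructor
  · rintro ⟨hp, d, ⟨a, ha, hd⟩, hd₀, hpd⟩
    rw [Cset_two_four] at ha
    have hdvd : d ∣ 2 ^ 4 * 3 ^ 2 * 5 * 7 * 47 := by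
      rcases ha with rfl | rfl | rfl <;> rcases hd with rfl | rfl | rfl | rfl | rfl | rfl <;>
        first | (norm_num at hd₀; done) | norm_num
    have hp' : p ∣ 2 ^ 4 * 3 ^ 2 * 5 * 7 * 47 := by exact_mod_cast hpd.trans hdvd
    have dvd_prime {q : ℕ} (hq : q.Prime) : p ∣ q → p = q :=
      (Nat.prime_dvd_prime_iff_eq hp hq).mp
    simp only [hp.dvd_mul] at hp'
    rcases hp' with (((h | h) | h) | h) | h
    · simp [dvd_prime (by norm_num) (hp.dvd_of_dvd_pow h)]
    · simp [dvd_prime (by norm_num) (hp.dvd_of_dvd_pow h)]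
    · simp [dvd_prime (by norm_num) h]
    · simp [dvd_prime (by norm_num) h]
    · simp [dvd_prime (by norm_num) h]
  · have h₈ : (8 : ℤ) ∈ Cset 2 4 := by simp [Cset_two_four]
    have h₁ : (1 : ℤ) ∈ Cset 2 4 := by simp [Cset_two_four]
    rintro (rfl | rfl | rfl | rfl | rfl)
    · exact ⟨by norm_num, 8, ⟨8, h₈, by norm_num⟩, by norm_num, by norm_num⟩
    · exact ⟨by norm_num, -3, ⟨1, h₁, by norm_num⟩, by norm_num, by norm_num⟩
    · exact ⟨by norm_num, 5, ⟨1, h₁, by norm_num⟩, by norm_num, by norm_num⟩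
    · exact ⟨by norm_num, -7, ⟨1, h₁, by norm_num⟩, by norm_num, by norm_num⟩
    · exact ⟨by norm_num, -47, ⟨1, h₁, by norm_num⟩, by norm_num, by norm_num⟩
end

section
/- P(D(3,2)) = {2, 3, 5, 11, 23}; that is, the set of prime numbers dividing some nonzero element of D(3,2) equals {2, 3, 5, 11, 23}. -/
open Complex in
/-- If `α` is a root of `T² + sT + N` with negative discriminant, then
`α² + conj(α)² = s² − 2N`. -/
theorem sq_add_conj_sq_of_root {s N : ℝ} (h : s ^ 2 < 4 * N) {α : ℂ}
    (hα : α ^ 2 + (s : ℂ) * α + (N : ℂ) = 0) :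
    α ^ 2 + (starRingEnd ℂ) α ^ 2 = ((s ^ 2 - 2 * N : ℝ) : ℂ) := by
  have hre : α.re ^ 2 - α.im ^ 2 + s * α.re + N = 0 := by
    have := congrArg Complex.re hα
    simp [pow_two] at this
    linarith
  have him : α.im * (2 * α.re + s) = 0 := by
    have := congrArg Complex.im hα
    simp [pow_two] at this
    linarith
  have hx : 2 * α.re + s = 0 := by
    rcases mul_eq_zero.mp him with hy | hx
    · rw [hy] at hre
      nlinarith [sq_nonneg (2 * α.re + s)]
    · exact hx
  apply Complex.ext
  · simp only [pow_two, add_re, mul_re, conj_re, conj_im, ofReal_re]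
    have hs : s = -2 * α.re := by linarith
    subst hs
    linarith
  · simp only [pow_two, add_im, mul_im, conj_re, conj_im, ofReal_im]
    ring

theorem exists_quadratic_root (b c : ℂ) : ∃ α : ℂ, α ^ 2 + b * α + c = 0 := by
  obtain ⟨z, hz⟩ := IsAlgClosed.exists_pow_nat_eq (b ^ 2 - 4 * c) two_pos
  exact ⟨(z - b) / 2, by linear_combination (1 / 4 : ℂ) * hz⟩

theorem mem_Cset_three_two {m : ℤ} :
    m ∈ Cset 3 2 ↔ m = -6 ∨ m = -5 ∨ m = -2 ∨ m = 3 := by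
  have key {s : ℤ} (hs : s ^ 2 < 4 * 3) {α : ℂ} (hα : α ^ 2 + (s : ℂ) * α + 3 = 0) :
      α ^ 2 + (starRingEnd ℂ) α ^ 2 = ((s ^ 2 - 6 : ℤ) : ℂ) := by
    have h : (s : ℝ) ^ 2 < 4 * 3 := by exact_mod_cast hs
    rw [sq_add_conj_sq_of_root h (by simpa using hα)]
    push_cast
    ring
  constructor
  · rintro ⟨s, hs, α, hα, hm⟩
    push_cast at hs hα
    have h₁ : -3 ≤ s := by nlinarith
    have h₂ : s ≤ 3 := by nlinarith
    have hs' : s ^ 2 < 4 * 3 := by nlinarith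
    have hms : m = s ^ 2 - 6 := by
      rw [key hs' hα] at hm
      exact_mod_cast hm.symm
    interval_cases s <;> omega
  · have mem (s : ℤ) (hs : s ^ 2 < 4 * 3) : s ^ 2 - 6 ∈ Cset 3 2 := by
      obtain ⟨α, hα⟩ := exists_quadratic_root s 3
      exact ⟨s, by push_cast; exact hs.le, α, by push_cast; exact hα, key hs hα⟩
    rintro (rfl | rfl | rfl | rfl)
    · simpa using mem 0 (by norm_num)
    · simpa using mem 1 (by norm_num)
    · simpa using mem 2 (by norm_num)
    · simpa using mem 3 (by norm_num)

theorem Pset_Dset_three_two : Pset (Dset 3 2) = {2, 3, 5, 11, 23} := by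
  ext p
  simp only [Set.mem_insert_iff, Set.mem_singleton_iff]
  constructor
  · rintro ⟨hp, d, ⟨a, ha, hd⟩, hd0, hpd⟩
    have hdvd : d ∣ 2 ^ 3 * 3 ^ 2 * 5 * 11 * 23 := by
      rcases mem_Cset_three_two.mp ha with rfl | rfl | rfl | rfl <;>
        rcases hd with rfl | rfl | rfl | rfl | rfl | rfl <;>
        first
          | norm_num; done
          | exact absurd (by norm_num) hd0
    have hp' : p ∣ 2 ^ 3 * 3 ^ 2 * 5 * 11 * 23 := by exact_mod_cast hpd.trans hdvd
    have eq_of_dvd {q : ℕ} (hq : q.Prime) (h : p ∣ q) : p = q :=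
      (Nat.prime_dvd_prime_iff_eq hp hq).mp h
    rcases hp.dvd_mul.mp hp' with h | h
    · rcases hp.dvd_mul.mp h with h | h
      · rcases hp.dvd_mul.mp h with h | h
        · rcases hp.dvd_mul.mp h with h | h
          · exact .inl (eq_of_dvd (by norm_num) (hp.dvd_of_dvd_pow h))
          · exact .inr (.inl (eq_of_dvd (by norm_num) (hp.dvd_of_dvd_pow h)))
        · exact .inr (.inr (.inl (eq_of_dvd (by norm_num) h)))
      · exact .inr (.inr (.inr (.inl (eq_of_dvd (by norm_num) h))))
    · exact .inr (.inr (.inr (.inr (eq_of_dvd (by norm_num) h))))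
  · have h₅ : (-5 : ℤ) ∈ Cset 3 2 := mem_Cset_three_two.mpr (by norm_num)
    have h₂ : (-2 : ℤ) ∈ Cset 3 2 := mem_Cset_three_two.mpr (by norm_num)
    have h₃ : (3 : ℤ) ∈ Cset 3 2 := mem_Cset_three_two.mpr (by norm_num)
    rintro (rfl | rfl | rfl | rfl | rfl)
    · exact ⟨by norm_num, -2, ⟨-2, h₂, by norm_num⟩, by norm_num, by norm_num⟩
    · exact ⟨by norm_num, 3, ⟨3, h₃, by norm_num⟩, by norm_num, by norm_num⟩
    · exact ⟨by norm_num, -5, ⟨-5, h₅, by norm_num⟩, by norm_num, by norm_num⟩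
    · exact ⟨by norm_num, -11, ⟨-5, h₅, by norm_num⟩, by norm_num, by norm_num⟩
    · exact ⟨by norm_num, -23, ⟨-2, h₂, by norm_num⟩, by norm_num, by norm_num⟩
end
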